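/- arXiv:2310.00988 — 3 statements merged into one kernel-verified Lean document; each statement's English description precedes it below -/
import Mathlib

section
/- Assume α = 1/2, β = 1 − γ, and 0 < γ < 1 (line L₁₂₃). Then there exist M > 0 and functions λ₁, λ₃ : ℝ → ℂ such that for every μ > M, λ₁(μ), its complex conjugate, λ₃(μ), and its complex conjugate are roots of f(·, μ), and as μ → ∞: Re λ₁(μ) = (−1/4 + √2/8)(1+o(1)), Im λ₁(μ) = √(2+√2) · μ^((1−γ)/2)(1+o(1)), Re λ₃(μ) = (−1/4 − √2/8)(1+o(1)), and Im λ₃(μ) = √(2−√2) · μ^((1−γ)/2)(1+o(1)). In particular, the real parts of all four roots stay bounded away from 0, consistent with exponential stability on L₁₂₃. -/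
open Filter Real Topology

/-- Characteristic polynomial of the thermoelastic system with Cattaneo's law,
with inertial coefficient `m = 1`, wave speed `σ = 2`, relaxation `τ = 1`:
`f(λ, μ) = (μ^γ+1)λ⁴ + (μ^γ+1)λ³ + (μ^(2α)+μ^(β+γ)+2μ+μ^β)λ² + (μ^(2α)+2μ)λ + 2μ^(1+β)`. -/
noncomputable def charPoly (α β γ μ : ℝ) (l : ℂ) : ℂ :=
  ((μ ^ γ + 1 : ℝ) : ℂ) * l ^ 4 + ((μ ^ γ + 1 : ℝ) : ℂ) * l ^ 3 +
    ((μ ^ (2 * α) + μ ^ (β + γ) + 2 * μ + μ ^ β : ℝ) : ℂ) * l ^ 2 +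
    ((μ ^ (2 * α) + 2 * μ : ℝ) : ℂ) * l + ((2 * μ ^ (1 + β) : ℝ) : ℂ)

/-- The ratio `a` such that, if `D ^ 2 = S ^ 2 - 4 * w`, the quadratic `l ^ 2 + a * l + s * (S + D) / 2`
is a candidate real factor; the complementary factor is obtained by replacing `D` with `-D`. -/
noncomputable def dampingCoeff (q S D : ℝ) : ℝ := 1 / 2 - (2 * q - S) / (2 * D)

/-- The root with nonnegative imaginary part of `l ^ 2 + a * l + B` when `a ^ 2 / 4 ≤ B`. -/
noncomputable def upperRoot (a B : ℝ) : ℂ := ⟨-a / 2, √(B - a ^ 2 / 4)⟩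

lemma upperRoot_isRoot {a B : ℝ} (h : a ^ 2 / 4 ≤ B) :
    upperRoot a B ^ 2 + a * upperRoot a B + B = 0 := by
  have hs : √(B - a ^ 2 / 4) ^ 2 = B - a ^ 2 / 4 := Real.sq_sqrt (by linarith)
  apply Complex.ext
  · rw [pow_two] at hs
    simp only [upperRoot, pow_two (Complex.mk _ _), Complex.add_re, Complex.mul_re, Complex.ofReal_re,
      Complex.ofReal_im, Complex.zero_re]
    linear_combination -hs
  · simp [upperRoot, pow_two]
    ring

lemma charPoly_conj (α β γ μ : ℝ) (l : ℂ) :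
    charPoly α β γ μ ((starRingEnd ℂ) l) = (starRingEnd ℂ) (charPoly α β γ μ l) := by
  simp only [charPoly, map_add, map_mul, map_pow, Complex.conj_ofReal]

/-- On the line `α = 1 / 2`, `β = 1 - γ`, the polynomial splits into two real quadratics as soon as
the coefficients match. -/
lemma charPoly_eq_zero_of_factor {γ μ a b c d : ℝ} {l : ℂ} (hμ : 0 < μ)
    (h3 : a + c = 1)
    (h2 : (μ ^ γ + 1) * (μ ^ (1 - γ) * (b + d) + a * c)
      = μ ^ (1 - γ) * (4 * μ ^ γ + 1))
    (h1 : (μ ^ γ + 1) * (a * d + c * b) = 3 * μ ^ γ)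
    (h0 : (μ ^ γ + 1) * (b * d) = 2 * μ ^ γ)
    (hl : l ^ 2 + a * l + (μ ^ (1 - γ) * b : ℝ) = 0) :
    charPoly (1 / 2) (1 - γ) γ μ l = 0 := by
  have e1 : μ ^ (1 - γ) * μ ^ γ = μ := by
    rw [← Real.rpow_add hμ]
    simp
  have e2 : μ ^ (1 + (1 - γ)) = μ ^ (1 - γ) * (μ ^ (1 - γ) * μ ^ γ) := by
    rw [e1, Real.rpow_add hμ, Real.rpow_one, mul_comm]
  have e3 : μ ^ (1 - γ + γ) = μ := by simp
  have e4 : μ ^ (2 * (1 / 2) : ℝ) = μ := by norm_num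
  unfold charPoly
  rw [e2, e3, e4]
  generalize μ ^ γ = P at *
  generalize μ ^ (1 - γ) = s at *
  subst e1
  have h3' : (a : ℂ) + c = 1 := by exact_mod_cast h3
  have h2' : ((P : ℂ) + 1) * (s * (b + d) + a * c) = s * (4 * P + 1) := by exact_mod_cast h2
  have h1' : ((P : ℂ) + 1) * (a * d + c * b) = 3 * P := by exact_mod_cast h1
  have h0' : ((P : ℂ) + 1) * (b * d) = 2 * P := by exact_mod_cast h0
  push_cast at hl ⊢
  linear_combination ((P : ℂ) + 1) * (l ^ 2 + c * l + s * d) * hl - ((P : ℂ) + 1) * l ^ 3 * h3'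
    - l ^ 2 * h2' - s * l * h1' - s ^ 2 * h0'

/-- The factorization condition, with `S = p - ε * t` the sum of the rescaled constant terms and
`t = a * c` the product of the linear coefficients, is solvable by the intermediate value theorem. -/
lemma exists_matching {p q w ε : ℝ} (hp : 39 / 10 ≤ p) (hq : 29 / 10 ≤ q)
    (hq' : q ≤ 3) (hw : w ≤ 2) (hε : 0 ≤ ε) (hε' : ε ≤ 1 / 10) :
    ∃ t ∈ Set.Icc (0 : ℝ) 1, 1 ≤ (p - ε * t) ^ 2 - 4 * w ∧
      (1 - 4 * t) * ((p - ε * t) ^ 2 - 4 * w) = (2 * q - (p - ε * t)) ^ 2 := by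
  have key : (0 : ℝ) ∈ (fun t : ℝ => (1 - 4 * t) * ((p - ε * t) ^ 2 - 4 * w)
      - (2 * q - (p - ε * t)) ^ 2) '' Set.Icc 0 1 := by
    apply intermediate_value_Icc' zero_le_one (by fun_prop)
    constructor
    · nlinarith [sq_nonneg (2 * q - (p - ε * 1))]
    · nlinarith
  obtain ⟨t, ht, h⟩ := key
  refine ⟨t, ht, ?_, by linarith⟩
  have : ε * t ≤ 1 / 10 := by nlinarith [ht.1, ht.2]
  nlinarith

/-- Given a solution of the matching condition, `upperRoot` is a root of the polynomial. -/
lemma charPoly_upperRoot {γ μ t q S D : ℝ} (hμ : 0 < μ)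
    (hq : (μ ^ γ + 1) * q = 3 * μ ^ γ)
    (hS : (μ ^ γ + 1) * (μ ^ (1 - γ) * S + t) = μ ^ (1 - γ) * (4 * μ ^ γ + 1))
    (hD : (μ ^ γ + 1) * (S ^ 2 - D ^ 2) = 8 * μ ^ γ) (hD0 : D ≠ 0)
    (ht : (1 - 4 * t) * D ^ 2 = (2 * q - S) ^ 2)
    (hB : dampingCoeff q S D ^ 2 / 4 ≤ μ ^ (1 - γ) * ((S + D) / 2)) :
    charPoly (1 / 2) (1 - γ) γ μ
      (upperRoot (dampingCoeff q S D) (μ ^ (1 - γ) * ((S + D) / 2))) = 0 := by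
  refine charPoly_eq_zero_of_factor (c := 1 / 2 + (2 * q - S) / (2 * D)) (d := (S - D) / 2) hμ
    ?_ ?_ ?_ ?_ (upperRoot_isRoot hB)
  · simp [dampingCoeff]
    norm_num
  · have : dampingCoeff q S D * (1 / 2 + (2 * q - S) / (2 * D)) = t := by
      unfold dampingCoeff
      field_simp
      linarith
    rw [this, ← hS]
    ring
  · rw [← hq]
    unfold dampingCoeff
    field_simp
    ring
  · linear_combination hD / 4

section Asymptotics

variable {q S D s : ℝ → ℝ} {D₀ : ℝ}

lemma tendsto_dampingCoeff (hq : Tendsto q atTop (𝓝 3)) (hS : Tendsto S atTop (𝓝 4))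
    (hD : Tendsto D atTop (𝓝 D₀)) (hD₀ : D₀ ≠ 0) :
    Tendsto (fun μ => dampingCoeff (q μ) (S μ) (D μ)) atTop (𝓝 (1 / 2 - 1 / D₀)) := by
  have := (((hq.const_mul 2).sub hS).div (hD.const_mul 2) (by simpa using hD₀)).const_sub (1 / 2)
  convert this using 2
  · rfl
  · field_simp
    norm_num

lemma tendsto_scaled_discr (hq : Tendsto q atTop (𝓝 3)) (hS : Tendsto S atTop (𝓝 4))
    (hD : Tendsto D atTop (𝓝 D₀)) (hD₀ : D₀ ≠ 0) (hs : Tendsto s atTop atTop) :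
    Tendsto (fun μ => (S μ + D μ) / 2 - dampingCoeff (q μ) (S μ) (D μ) ^ 2 / 4 * (s μ)⁻¹) atTop
      (𝓝 ((4 + D₀) / 2)) := by
  simpa using ((hS.add hD).div_const 2).sub
    ((((tendsto_dampingCoeff hq hS hD hD₀).pow 2).div_const 4).mul hs.inv_tendsto_atTop)

lemma eventually_discr_nonneg (hq : Tendsto q atTop (𝓝 3)) (hS : Tendsto S atTop (𝓝 4))
    (hD : Tendsto D atTop (𝓝 D₀)) (hD₀ : D₀ ≠ 0) (hs : Tendsto s atTop atTop)
    (h4 : 0 < 4 + D₀) :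
    ∀ᶠ μ in atTop, dampingCoeff (q μ) (S μ) (D μ) ^ 2 / 4 ≤ s μ * ((S μ + D μ) / 2) := by
  filter_upwards [(tendsto_scaled_discr hq hS hD hD₀ hs).eventually_const_lt (half_pos h4),
    hs.eventually_gt_atTop 0] with μ h hpos
  have := mul_pos hpos h
  field_simp at this ⊢
  linarith

lemma tendsto_upperRoot_im (hq : Tendsto q atTop (𝓝 3)) (hS : Tendsto S atTop (𝓝 4))
    (hD : Tendsto D atTop (𝓝 D₀)) (hD₀ : D₀ ≠ 0) (hs : Tendsto s atTop atTop)
    (h4 : 0 < 4 + D₀) :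
    Tendsto (fun μ => (upperRoot (dampingCoeff (q μ) (S μ) (D μ))
      (s μ * ((S μ + D μ) / 2))).im / (√((4 + D₀) / 2) * √(s μ))) atTop (𝓝 1) := by
  have h0 : √((4 + D₀) / 2) ≠ 0 := (Real.sqrt_pos.2 (half_pos h4)).ne'
  have := (tendsto_scaled_discr hq hS hD hD₀ hs).sqrt.div_const √((4 + D₀) / 2)
  rw [div_self h0] at this
  refine this.congr' ?_
  filter_upwards [hs.eventually_gt_atTop 0] with μ hpos
  have hsq : √(s μ) ≠ 0 := (Real.sqrt_pos.2 hpos).ne'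
  have e : s μ * ((S μ + D μ) / 2) - dampingCoeff (q μ) (S μ) (D μ) ^ 2 / 4
      = s μ * ((S μ + D μ) / 2 - dampingCoeff (q μ) (S μ) (D μ) ^ 2 / 4 * (s μ)⁻¹) := by
    field_simp
  simp only [upperRoot]
  rw [e, Real.sqrt_mul hpos.le]
  field_simp

end Asymptotics

theorem charPoly_roots_L123 (α β γ : ℝ)
    (h1 : α = 1 / 2) (h2 : β = 1 - γ)
    (h3 : 0 < γ) (h4 : γ < 1) :
    ∃ M > (0 : ℝ), ∃ l1 l3 : ℝ → ℂ,
      (∀ μ > M,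
        charPoly α β γ μ (l1 μ) = 0 ∧ charPoly α β γ μ ((starRingEnd ℂ) (l1 μ)) = 0 ∧
        charPoly α β γ μ (l3 μ) = 0 ∧ charPoly α β γ μ ((starRingEnd ℂ) (l3 μ)) = 0) ∧
      Tendsto (fun μ : ℝ => (l1 μ).re / (-(1 / 4) + Real.sqrt 2 / 8 : ℝ)) atTop (𝓝 1) ∧
      Tendsto (fun μ : ℝ => (l1 μ).im / (Real.sqrt (2 + Real.sqrt 2) * μ ^ ((1 - γ) / 2))) atTop (𝓝 1) ∧
      Tendsto (fun μ : ℝ => (l3 μ).re / (-(1 / 4) - Real.sqrt 2 / 8 : ℝ)) atTop (𝓝 1) ∧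
      Tendsto (fun μ : ℝ => (l3 μ).im / (Real.sqrt (2 - Real.sqrt 2) * μ ^ ((1 - γ) / 2))) atTop (𝓝 1) ∧
      ∃ c > (0 : ℝ), ∃ M' : ℝ, ∀ μ > M', (l1 μ).re ≤ -c ∧ (l3 μ).re ≤ -c := by
  subst h1 h2
  set s : ℝ → ℝ := fun μ => μ ^ (1 - γ) with hs_def
  set p : ℝ → ℝ := fun μ => (4 * μ ^ γ + 1) / (μ ^ γ + 1) with hp_def
  set q : ℝ → ℝ := fun μ => 3 * μ ^ γ / (μ ^ γ + 1) with hq_def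
  set w : ℝ → ℝ := fun μ => 2 * μ ^ γ / (μ ^ γ + 1) with hw_def
  have hP : Tendsto (fun μ : ℝ => μ ^ γ) atTop atTop := tendsto_rpow_atTop h3
  have hs : Tendsto s atTop atTop := tendsto_rpow_atTop (by linarith)
  have hδ : Tendsto (fun μ : ℝ => (μ ^ γ + 1)⁻¹) atTop (𝓝 0) :=
    (tendsto_atTop_add_const_right _ 1 hP).inv_tendsto_atTop
  have hpos : ∀ᶠ μ : ℝ in atTop, 0 < μ ^ γ := hP.eventually_gt_atTop 0
  have hp : Tendsto p atTop (𝓝 4) := by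
    have := (hδ.const_mul 3).const_sub 4
    rw [mul_zero, sub_zero] at this
    refine this.congr' ?_
    filter_upwards [hpos] with μ h
    simp only [hp_def]
    field_simp
    ring
  have hq : Tendsto q atTop (𝓝 3) := by
    have := (hδ.const_mul 3).const_sub 3
    rw [mul_zero, sub_zero] at this
    refine this.congr' ?_
    filter_upwards [hpos] with μ h
    simp only [hq_def]
    field_simp
    ring
  have hw : Tendsto w atTop (𝓝 2) := by
    have := (hδ.const_mul 2).const_sub 2
    rw [mul_zero, sub_zero] at this
    refine this.congr' ?_
    filter_upwards [hpos] with μ h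
    simp only [hw_def]
    field_simp
    ring
  have hε : Tendsto (fun μ => (s μ)⁻¹) atTop (𝓝 0) := hs.inv_tendsto_atTop
  have hex : ∀ᶠ μ in atTop, ∃ t ∈ Set.Icc (0 : ℝ) 1, 1 ≤ (p μ - (s μ)⁻¹ * t) ^ 2 - 4 * w μ ∧
      (1 - 4 * t) * ((p μ - (s μ)⁻¹ * t) ^ 2 - 4 * w μ)
        = (2 * q μ - (p μ - (s μ)⁻¹ * t)) ^ 2 := by
    filter_upwards [hpos, hp.eventually_const_le (show (39 / 10 : ℝ) < 4 by norm_num),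
      hq.eventually_const_le (show (29 / 10 : ℝ) < 3 by norm_num),
      hε.eventually_le_const (show (0 : ℝ) < 1 / 10 by norm_num),
      hs.eventually_gt_atTop 0] with μ h hp' hq' hε' hs'
    refine exists_matching hp' hq' ?_ ?_ (inv_nonneg.2 hs'.le) hε'
    · simp only [hq_def]
      rw [div_le_iff₀ (by linarith)]
      linarith
    · simp only [hw_def]
      rw [div_le_iff₀ (by linarith)]
      linarith
  obtain ⟨t, ht⟩ := hex.choice
  set S : ℝ → ℝ := fun μ => p μ - (s μ)⁻¹ * t μ with hS_def
  have hS : Tendsto S atTop (𝓝 4) := by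
    have h0 : Tendsto (fun μ => (s μ)⁻¹ * t μ) atTop (𝓝 0) := by
      refine tendsto_of_tendsto_of_tendsto_of_le_of_le' tendsto_const_nhds hε ?_ ?_
      · filter_upwards [ht, hs.eventually_gt_atTop 0] with μ h hs'
        exact mul_nonneg (inv_nonneg.2 hs'.le) h.1.1
      · filter_upwards [ht, hs.eventually_gt_atTop 0] with μ h hs'
        exact mul_le_of_le_one_right (inv_nonneg.2 hs'.le) h.1.2
    simpa using hp.sub h0
  set D : ℝ → ℝ := fun μ => √(S μ ^ 2 - 4 * w μ) with hD_def
  have h2sq : √2 ^ 2 = 2 := Real.sq_sqrt zero_le_two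
  have h2pos : 0 < √2 := by positivity
  have h2lt : √2 < 3 / 2 := by nlinarith
  have hD : Tendsto D atTop (𝓝 (2 * √2)) := by
    have := ((hS.pow 2).sub (hw.const_mul 4)).sqrt
    convert this using 2
    rw [eq_comm, Real.sqrt_eq_iff_mul_self_eq (by norm_num) (by positivity)]
    nlinarith
  have hroot : ∀ E : ℝ → ℝ, (∀ μ, E μ ^ 2 = D μ ^ 2) → ∀ D₀, Tendsto E atTop (𝓝 D₀) →
      D₀ ≠ 0 → 0 < 4 + D₀ → ∀ᶠ μ in atTop, charPoly (1 / 2) (1 - γ) γ μ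
        (upperRoot (dampingCoeff (q μ) (S μ) (E μ)) (s μ * ((S μ + E μ) / 2))) = 0 := by
    intro E hE D₀ hlim hne h4'
    filter_upwards [eventually_discr_nonneg hq hS hlim hne hs h4', ht, eventually_gt_atTop 0,
      hs.eventually_gt_atTop 0, hpos] with μ hB hμt hμ hsμ hPμ
    have hDsq : E μ ^ 2 = S μ ^ 2 - 4 * w μ := by
      rw [hE, Real.sq_sqrt (by linarith [hμt.2.1])]
    have hP1 : μ ^ γ + 1 ≠ 0 := by positivity
    refine charPoly_upperRoot (t := t μ) hμ ?_ ?_ ?_ ?_ ?_ hB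
    · simp only [hq_def]
      field_simp
    · have : s μ * S μ + t μ = s μ * p μ := by
        simp only [hS_def]
        field_simp
        ring
      change (μ ^ γ + 1) * (s μ * S μ + t μ) = s μ * _
      rw [this]
      simp only [hp_def]
      field_simp
    · rw [hDsq]
      simp only [hw_def]
      field_simp
      ring
    · intro h
      rw [h] at hDsq
      linarith [hμt.2.1]
    · rw [hDsq]
      exact hμt.2.2
  have hne : 2 * √2 ≠ 0 := by positivity
  have hre1 := ((tendsto_dampingCoeff hq hS hD hne).neg).div_const 2
  have hre3 := ((tendsto_dampingCoeff hq hS hD.neg (neg_ne_zero.2 hne)).neg).div_const 2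
  have v1 : -(1 / 2 - 1 / (2 * √2)) / 2 = -(1 / 4) + √2 / 8 := by
    field_simp
    nlinarith
  have v3 : -(1 / 2 - 1 / (-(2 * √2))) / 2 = -(1 / 4) - √2 / 8 := by
    field_simp
    nlinarith
  rw [v1] at hre1
  rw [v3] at hre3
  have hsqrt : ∀ᶠ μ : ℝ in atTop, √(s μ) = μ ^ ((1 - γ) / 2) := by
    filter_upwards [eventually_ge_atTop 0] with μ hμ
    simp only [hs_def]
    rw [Real.sqrt_eq_rpow, ← Real.rpow_mul hμ]
    ring_nf
  have him1 := tendsto_upperRoot_im hq hS hD hne hs (by positivity)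
  have him3 := tendsto_upperRoot_im hq hS hD.neg (neg_ne_zero.2 hne) hs (by linarith)
  have u1 : (4 + 2 * √2) / 2 = 2 + √2 := by ring
  have u3 : (4 + -(2 * √2)) / 2 = 2 - √2 := by ring
  rw [u1] at him1
  rw [u3] at him3
  obtain ⟨M, hM⟩ := eventually_atTop.1 ((hroot D (fun _ => rfl) _ hD hne (by positivity)).and
    (hroot (fun μ => -D μ) (fun _ => neg_sq _) _ hD.neg (neg_ne_zero.2 hne) (by linarith)))
  obtain ⟨M', hM'⟩ := eventually_atTop.1 ((hre1.eventually_le_const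
    (show -(1 / 4) + √2 / 8 < -(1 / 20) by linarith)).and (hre3.eventually_le_const
    (show -(1 / 4) - √2 / 8 < -(1 / 20) by linarith)))
  refine ⟨max M 1, by positivity,
    fun μ => upperRoot (dampingCoeff (q μ) (S μ) (D μ)) (s μ * ((S μ + D μ) / 2)),
    fun μ => upperRoot (dampingCoeff (q μ) (S μ) (-D μ)) (s μ * ((S μ + -D μ) / 2)),
    fun μ hμ => ?_, ?_, ?_, ?_, ?_, 1 / 20, by norm_num, M', fun μ hμ => hM' μ hμ.le⟩
  · obtain ⟨r1, r3⟩ := hM μ ((le_max_left _ _).trans hμ.le)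
    exact ⟨r1, by rw [charPoly_conj, r1, map_zero], r3, by rw [charPoly_conj, r3, map_zero]⟩
  · have := hre1.div_const (-(1 / 4) + √2 / 8)
    rwa [div_self (by linarith)] at this
  · refine him1.congr' ?_
    filter_upwards [hsqrt] with μ h
    rw [h]
  · have := hre3.div_const (-(1 / 4) - √2 / 8)
    rwa [div_self (by linarith)] at this
  · refine him3.congr' ?_
    filter_upwards [hsqrt] with μ h
    rw [h]
end

section
/- Assume α = 1/2, β = 0, and 0 < γ < 1 (line L₁₂₄). Then there exist M > 0 and functions λ₁, λ₃ : ℝ → ℂ such that for every μ > M, λ₁(μ), its complex conjugate, λ₃(μ), and its complex conjugate are roots of f(·, μ), and as μ → ∞: Re λ₁(μ) = −(1/18)μ^(γ−1)(1+o(1)), Im λ₁(μ) = √3 · μ^((1−γ)/2)(1+o(1)), Re λ₃(μ) = −(1/2)(1+o(1)), and Im λ₃(μ) = (√15/6)(1+o(1)). -/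
open Filter Real Topology

/-- For small `e`, the quartic `e * l ^ 2 * (l ^ 2 + l + 1) + 3 * l ^ 2 + 3 * l + 2` splits into
`(l ^ 2 + (1 - r) * l + 2 / S) * (e * l ^ 2 + e * r * l + S)` with `S` close to `3`
and `r` of order `e`. -/
theorem exists_quadratic_factor (e : ℝ) (he : 0 < e) (he1 : e ≤ 1) :
    ∃ S r : ℝ, 3 ≤ S ∧ S ≤ 3 + e ∧ r * (S - e * (2 / S)) = S - 3 ∧
      S - 3 = e * (1 - 2 / S - r + r ^ 2) := by
  have hden : ∀ S ∈ Set.Icc 3 (3 + e), 0 < S ∧ 2 ≤ S - e * (2 / S) := by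
    rintro S ⟨hS, -⟩
    have h0 : 0 < S := by linarith
    have h1 : 2 / S ≤ 1 := by rw [div_le_one h0]; linarith
    have h2 : 0 ≤ 2 / S := by positivity
    exact ⟨h0, by nlinarith⟩
  let R : ℝ → ℝ := fun S => (S - 3) / (S - e * (2 / S))
  let G : ℝ → ℝ := fun S => S - 3 - e * (1 - 2 / S - R S + R S ^ 2)
  have hq : ContinuousOn (fun S : ℝ => 2 / S) (Set.Icc 3 (3 + e)) :=
    continuousOn_const.div continuousOn_id fun S hS => (hden S hS).1.ne'
  have hR : ContinuousOn R (Set.Icc 3 (3 + e)) :=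
    (continuousOn_id.sub continuousOn_const).div
      (continuousOn_id.sub (continuousOn_const.mul hq)) fun S hS => by
        have := (hden S hS).2
        exact (by linarith : (0 : ℝ) < S - e * (2 / S)).ne'
  have hG : ContinuousOn G (Set.Icc 3 (3 + e)) :=
    (continuousOn_id.sub continuousOn_const).sub
      (continuousOn_const.mul (((continuousOn_const.sub hq).sub hR).add (hR.pow 2)))
  have hmem : (0 : ℝ) ∈ Set.Icc (G 3) (G (3 + e)) := by
    constructor
    · simp only [G, R, sub_self, zero_div]
      nlinarith
    · obtain ⟨h0, h2⟩ := hden (3 + e) ⟨by linarith, le_rfl⟩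
      have hr0 : 0 ≤ R (3 + e) := div_nonneg (by linarith) (by linarith)
      have hr1 : R (3 + e) ≤ 1 := by
        rw [div_le_one (by linarith)]
        linarith
      have hq0 : 0 < 2 / (3 + e) := by positivity
      have hrr : 0 ≤ R (3 + e) * (1 - R (3 + e)) := mul_nonneg hr0 (by linarith)
      have : 0 ≤ e * (2 / (3 + e) + R (3 + e) * (1 - R (3 + e))) := by positivity
      simp only [G]
      linarith
  obtain ⟨S, hS, hGS⟩ := intermediate_value_Icc (by linarith) hG hmem
  refine ⟨S, R S, hS.1, hS.2, div_mul_cancel₀ _ ?_, ?_⟩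
  · have := (hden S hS).2
    linarith
  · simp only [G] at hGS
    linarith

/-- The explicit complex root of a real monic quadratic with nonpositive discriminant,
together with its conjugate. -/
theorem quadratic_root_and_conj (b c : ℝ) (h : b ^ 2 / 4 ≤ c) (z : ℂ)
    (hz : z = ⟨-b / 2, √(c - b ^ 2 / 4)⟩) :
    z ^ 2 + b * z + c = 0 ∧
      (starRingEnd ℂ) z ^ 2 + b * (starRingEnd ℂ) z + c = 0 := by
  have hs : √(c - b ^ 2 / 4) * √(c - b ^ 2 / 4) = c - b ^ 2 / 4 :=
    Real.mul_self_sqrt (by linarith)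
  have h1 : z ^ 2 + b * z + c = 0 := by
    subst hz
    apply Complex.ext
    · simp [pow_two]
      rw [pow_two] at hs
      linarith
    · simp [pow_two]
      ring
  refine ⟨h1, ?_⟩
  simpa using congrArg (starRingEnd ℂ) h1

/-- The factorization of the characteristic polynomial for `α = 1 / 2`, `β = 0`. -/
theorem charPoly_eq_mul (γ μ e S r : ℝ) (he : μ * e = μ ^ γ + 1) (he0 : 0 < e)
    (hS : 3 ≤ S) (h1 : r * (S - e * (2 / S)) = S - 3)
    (h2 : S - 3 = e * (1 - 2 / S - r + r ^ 2)) (l : ℂ) :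
    charPoly (1 / 2) 0 γ μ l =
      μ * e * (l ^ 2 + (r : ℝ) * l + (S / e : ℝ)) * (l ^ 2 + (1 - r : ℝ) * l + (2 / S : ℝ)) := by
  have hS0 : S ≠ 0 := by linarith
  have hq : S * (2 / S) = 2 := by field_simp
  have hs : e * (S / e) = S := by field_simp
  generalize 2 / S = q at *
  generalize S / e = s at *
  have hγ : μ ^ γ = μ * e - 1 := by linarith
  unfold charPoly
  norm_num [hγ]
  have hq' : (S : ℂ) * q = 2 := by exact_mod_cast hq
  have hs' : (e : ℂ) * s = S := by exact_mod_cast hs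
  have h1' : (r : ℂ) * (S - e * q) = S - 3 := by exact_mod_cast h1
  have h2' : (S : ℂ) - 3 = e * (1 - q - r + r ^ 2) := by exact_mod_cast h2
  linear_combination (-(μ : ℂ)) * hq' - μ * (l ^ 2 + (1 - r) * l + q) * hs' + μ * l * h1' -
    μ * l ^ 2 * h2'

theorem charPoly_roots_L124 (α β γ : ℝ)
    (h1 : α = 1 / 2) (h2 : β = 0)
    (h3 : 0 < γ) (h4 : γ < 1) :
    ∃ M > (0 : ℝ), ∃ l1 l3 : ℝ → ℂ,
      (∀ μ > M,
        charPoly α β γ μ (l1 μ) = 0 ∧ charPoly α β γ μ ((starRingEnd ℂ) (l1 μ)) = 0 ∧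
        charPoly α β γ μ (l3 μ) = 0 ∧ charPoly α β γ μ ((starRingEnd ℂ) (l3 μ)) = 0) ∧
      Tendsto (fun μ : ℝ => (l1 μ).re / (-(1 / 18) * μ ^ (γ - 1))) atTop (𝓝 1) ∧
      Tendsto (fun μ : ℝ => (l1 μ).im / (Real.sqrt 3 * μ ^ ((1 - γ) / 2))) atTop (𝓝 1) ∧
      Tendsto (fun μ : ℝ => (l3 μ).re / (-(1 / 2) : ℝ)) atTop (𝓝 1) ∧
      Tendsto (fun μ : ℝ => (l3 μ).im / (Real.sqrt 15 / 6 : ℝ)) atTop (𝓝 1) := by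
  subst h1 h2
  have key : ∀ e : ℝ, ∃ S r : ℝ, 0 < e → e ≤ 1 → 3 ≤ S ∧ S ≤ 3 + e ∧
      r * (S - e * (2 / S)) = S - 3 ∧ S - 3 = e * (1 - 2 / S - r + r ^ 2) := by
    intro e
    by_cases h : 0 < e ∧ e ≤ 1
    · obtain ⟨S, r, hS⟩ := exists_quadratic_factor e h.1 h.2
      exact ⟨S, r, fun _ _ => hS⟩
    · exact ⟨0, 0, fun ha hb => absurd ⟨ha, hb⟩ h⟩
  choose S' r' hSr' using key
  let e : ℝ → ℝ := fun μ => μ ^ (γ - 1) + μ⁻¹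
  obtain ⟨S, hSdef⟩ : ∃ S : ℝ → ℝ, ∀ μ, S μ = S' (e μ) := ⟨_, fun _ => rfl⟩
  obtain ⟨r, hrdef⟩ : ∃ r : ℝ → ℝ, ∀ μ, r μ = r' (e μ) := ⟨_, fun _ => rfl⟩
  have hk : Tendsto (fun μ : ℝ => μ ^ (γ - 1)) atTop (𝓝 0) := by
    simpa using tendsto_rpow_neg_atTop (sub_pos.2 h4)
  have he : Tendsto e atTop (𝓝 0) := by simpa using hk.add tendsto_inv_atTop_zero
  have hkpos : ∀ {μ : ℝ}, 0 < μ → 0 < μ ^ (γ - 1) := fun h => rpow_pos_of_pos h _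
  have hepos : ∀ {μ : ℝ}, 0 < μ → 0 < e μ := fun h => add_pos (hkpos h) (inv_pos.2 h)
  obtain ⟨M, hM⟩ := eventually_atTop.1 (he.eventually_le_const one_pos)
  have hSr : ∀ μ > max M 1, 0 < μ ∧ 0 < e μ ∧ e μ ≤ 1 ∧ 3 ≤ S μ ∧ S μ ≤ 3 + e μ ∧
      r μ * (S μ - e μ * (2 / S μ)) = S μ - 3 ∧
      S μ - 3 = e μ * (1 - 2 / S μ - r μ + r μ ^ 2) := by
    intro μ hμ
    have h0 : 0 < μ := one_pos.trans ((le_max_right _ _).trans_lt hμ)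
    have h1 : e μ ≤ 1 := hM μ ((le_max_left _ _).trans hμ.le)
    rw [hSdef, hrdef]
    exact ⟨h0, hepos h0, h1, hSr' _ (hepos h0) h1⟩
  have hbd : ∀ μ > max M 1, 0 ≤ r μ ∧ r μ ≤ e μ / 2 := by
    intro μ hμ
    obtain ⟨-, h0, h1, hS3, hS4, hr, -⟩ := hSr μ hμ
    have hq0 : 0 ≤ 2 / S μ := by positivity
    have hq1 : 2 / S μ ≤ 1 := by rw [div_le_one (by linarith)]; linarith
    have hd : 2 ≤ S μ - e μ * (2 / S μ) := by nlinarith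
    have hr0 : 0 ≤ r μ := by
      by_contra! hneg
      nlinarith
    exact ⟨hr0, by nlinarith⟩
  have hev : ∀ᶠ μ in atTop, μ > max M 1 := eventually_gt_atTop _
  have hr0 : Tendsto r atTop (𝓝 0) := by
    refine tendsto_of_tendsto_of_tendsto_of_le_of_le' tendsto_const_nhds
      (by simpa using he.div_const 2) ?_ ?_
    · filter_upwards [hev] with μ hμ using (hbd μ hμ).1
    · filter_upwards [hev] with μ hμ using (hbd μ hμ).2
  have hS3 : Tendsto S atTop (𝓝 3) := by
    refine tendsto_of_tendsto_of_tendsto_of_le_of_le' tendsto_const_nhds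
      (by simpa using he.const_add 3) ?_ ?_
    · filter_upwards [hev] with μ hμ using (hSr μ hμ).2.2.2.1
    · filter_upwards [hev] with μ hμ using (hSr μ hμ).2.2.2.2.1
  have hq : Tendsto (fun μ => 2 / S μ) atTop (𝓝 (2 / 3)) :=
    tendsto_const_nhds.div hS3 (by norm_num)
  have hek : Tendsto (fun μ => e μ / μ ^ (γ - 1)) atTop (𝓝 1) := by
    have h : Tendsto (fun μ : ℝ => 1 + μ ^ (-γ)) atTop (𝓝 1) := by
      simpa using (tendsto_rpow_neg_atTop h3).const_add 1
    refine h.congr' ?_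
    filter_upwards [eventually_gt_atTop 0] with μ hμ
    have h' : μ⁻¹ = μ ^ (-γ) * μ ^ (γ - 1) := by
      rw [← rpow_add hμ, ← rpow_neg_one]
      ring_nf
    have := (hkpos hμ).ne'
    simp only [e, h']
    field_simp
  have hre : Tendsto (fun μ => r μ / e μ) atTop (𝓝 (1 / 9)) := by
    have h : Tendsto (fun μ => (1 - 2 / S μ - r μ + r μ ^ 2) / (S μ - e μ * (2 / S μ))) atTop
        (𝓝 ((1 - 2 / 3 - 0 + 0 ^ 2) / (3 - 0 * (2 / 3)))) :=
      (((hq.const_sub 1).sub hr0).add (hr0.pow 2)).div (hS3.sub (he.mul hq)) (by norm_num)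
    norm_num at h
    norm_num
    refine h.congr' ?_
    filter_upwards [hev] with μ hμ
    obtain ⟨-, h0, h1, hS3, hS4, hr, hG⟩ := hSr μ hμ
    have hq0 : 0 ≤ 2 / S μ := by positivity
    have hq1 : 2 / S μ ≤ 1 := by rw [div_le_one (by linarith)]; linarith
    have hd : 2 ≤ S μ - e μ * (2 / S μ) := by nlinarith
    rw [div_eq_div_iff (by linarith) h0.ne']
    linarith
  refine ⟨max M 1, by positivity, fun μ => ⟨-r μ / 2, √(S μ / e μ - r μ ^ 2 / 4)⟩,
    fun μ => ⟨-(1 - r μ) / 2, √(2 / S μ - (1 - r μ) ^ 2 / 4)⟩, ?_, ?_, ?_, ?_, ?_⟩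
  · intro μ hμ
    obtain ⟨hμ0, h0, h1, hS3, hS4, hr, hG⟩ := hSr μ hμ
    obtain ⟨hr0, hr1⟩ := hbd μ hμ
    have hmul : μ * e μ = μ ^ γ + 1 := by
      have h : μ * μ ^ (γ - 1) = μ ^ γ := by
        rw [← rpow_one_add' hμ0.le (by linarith)]
        ring_nf
      rw [mul_add, h, mul_inv_cancel₀ hμ0.ne']
    have hfac := charPoly_eq_mul γ μ (e μ) (S μ) (r μ) hmul h0 hS3 hr hG
    have hs : r μ ^ 2 / 4 ≤ S μ / e μ := by
      rw [le_div_iff₀ h0]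
      nlinarith
    have hq : (1 - r μ) ^ 2 / 4 ≤ 2 / S μ := by
      rw [le_div_iff₀ (by linarith)]
      nlinarith
    obtain ⟨ha, ha'⟩ := quadratic_root_and_conj (r μ) (S μ / e μ) hs _ rfl
    obtain ⟨hb, hb'⟩ := quadratic_root_and_conj (1 - r μ) (2 / S μ) hq _ rfl
    refine ⟨?_, ?_, ?_, ?_⟩
    · rw [hfac, ha]; ring
    · rw [hfac, ha']; ring
    · rw [hfac, hb]; ring
    · rw [hfac, hb']; ring
  · have h := (hre.mul hek).const_mul 9
    norm_num at h
    refine h.congr' ?_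
    filter_upwards [eventually_gt_atTop 0] with μ hμ
    have := (hkpos hμ).ne'
    have := (hepos hμ).ne'
    field_simp
    ring
  · have h : Tendsto (fun μ => √((S μ / (e μ / μ ^ (γ - 1)) -
        μ ^ (γ - 1) * (r μ ^ 2 / 4)) / 3)) atTop (𝓝 √((3 / 1 - 0 * (0 ^ 2 / 4)) / 3)) :=
      (((hS3.div hek one_ne_zero).sub (hk.mul ((hr0.pow 2).div_const 4))).div_const 3).sqrt
    rw [show √((3 / 1 - 0 * (0 ^ 2 / 4)) / 3) = 1 by norm_num] at h
    refine h.congr' ?_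
    filter_upwards [eventually_gt_atTop 0] with μ hμ
    have hk0 := hkpos hμ
    have he0 := hepos hμ
    have hroot : μ ^ ((1 - γ) / 2) = √((μ ^ (γ - 1))⁻¹) := by
      rw [← rpow_neg hμ.le, Real.sqrt_eq_rpow, ← rpow_mul hμ.le]
      ring_nf
    rw [hroot, ← Real.sqrt_mul (by norm_num), ← Real.sqrt_div' _ (by positivity)]
    congr 1
    field_simp
  · have h := (hr0.const_sub 1)
    rw [sub_zero] at h
    refine h.congr fun μ => ?_
    ring
  · have h : Tendsto (fun μ => √(2 / S μ - (1 - r μ) ^ 2 / 4) / (√15 / 6)) atTop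
        (𝓝 (√(2 / 3 - (1 - 0) ^ 2 / 4) / (√15 / 6))) :=
      ((hq.sub (((hr0.const_sub 1).pow 2).div_const 4)).sqrt).div_const _
    have h15 : √(2 / 3 - (1 - 0) ^ 2 / 4) = √15 / 6 := by
      rw [show (2 / 3 - (1 - 0) ^ 2 / 4 : ℝ) = 15 / 6 ^ 2 by norm_num,
        Real.sqrt_div (by norm_num), Real.sqrt_sq (by norm_num)]
    rwa [h15, div_self (by positivity)] at h
end

section
/- Assume 1/2 < α < (β+1)/2, 0 < β ≤ 1, and 0 < γ < 2α − β (region T₁). Then there exists a function λ : ℝ → ℂ and M > 0 such that for every μ > M, λ(μ) is a root of f(·, μ), and as μ → ∞, |Re λ(μ)| · |Im λ(μ)|^(2(2α−β−γ)/(2α−γ)) → 1/2 while |Im λ(μ)| → ∞; that is, along this sequence of characteristic roots, Re λ is comparable to −|Im λ|^(−1/k₁) with k₁ = (2α−γ)/(2(2α−β−γ)), which shows the polynomial decay rate t^(−k₁) in region V₁ is optimal. -/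
open Filter Real Topology

/-- A monic complex polynomial of degree `n` has a root `r` with `‖z - r‖ ^ n ≤ ‖p z‖`. -/
lemma Polynomial.Monic.exists_root_norm_sub_pow_le {p : Polynomial ℂ} (hp : p.Monic)
    (hdeg : p.natDegree ≠ 0) (z : ℂ) :
    ∃ r, p.eval r = 0 ∧ ‖z - r‖ ^ p.natDegree ≤ ‖p.eval z‖ := by
  have hsplit : p.Splits := IsAlgClosed.splits p
  have hcard : p.natDegree = p.roots.card := hsplit.natDegree_eq_card_roots
  have hne : p.roots.toFinset.Nonempty := by
    rw [Multiset.toFinset_nonempty]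
    intro h
    rw [h, Multiset.card_zero] at hcard
    exact hdeg hcard
  obtain ⟨r, hr, hmin⟩ := p.roots.toFinset.exists_min_image (fun r => ‖z - r‖) hne
  have hprod : ∀ s : Multiset ℂ, (∀ x ∈ s, ‖z - r‖ ≤ ‖z - x‖) →
      ‖z - r‖ ^ s.card ≤ ‖(s.map fun x => z - x).prod‖ := by
    intro s
    induction s using Multiset.induction with
    | empty => simp
    | cons a s ih =>
      intro h
      rw [Multiset.card_cons, pow_succ', Multiset.map_cons, Multiset.prod_cons, norm_mul]
      have ha := h a (Multiset.mem_cons_self a s)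
      have hs := ih fun x hx => h x (Multiset.mem_cons_of_mem hx)
      gcongr
  refine ⟨r, (Polynomial.mem_roots'.1 (Multiset.mem_toFinset.1 hr)).2, ?_⟩
  rw [hsplit.eval_eq_prod_roots_of_monic hp, hcard]
  exact hprod _ fun x hx => hmin x (Multiset.mem_toFinset.2 hx)

/-- The imaginary part of `conj (z * (z + a)) * g z` for a root `z = u + i v` of
`g z = z * (z + a) * (z ^ 2 + s) + ρ * z ^ 2 + η * ρ`, divided by `v`. -/
lemma re_relation_of_root {a s ρ η : ℝ} {z : ℂ}
    (hz : z ^ 4 + a * z ^ 3 + (s + ρ) * z ^ 2 + s * a * z + η * ρ = 0) (hv : z.im ≠ 0) :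
    2 * z.re * ((z.re ^ 2 + z.im ^ 2) * ((z.re + a) ^ 2 + z.im ^ 2) - η * ρ) =
      a * ρ * (η - (z.re ^ 2 + z.im ^ 2)) := by
  obtain ⟨u, v⟩ := z
  have hre := congrArg Complex.re hz
  have him := congrArg Complex.im hz
  simp only [pow_succ, pow_zero, one_mul, Complex.add_re, Complex.mul_re, Complex.add_im,
    Complex.mul_im, Complex.ofReal_re, Complex.ofReal_im, Complex.zero_re, Complex.zero_im]
    at hre him
  simp only at hv ⊢
  apply mul_left_cancel₀ hv
  linear_combination (u ^ 2 - v ^ 2 + a * u) * him - (2 * u * v + a * v) * hre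

/-- Roots near `i` of a perturbation of `z ^ 4 + z ^ 2`, with the asymptotics of the real part. -/
lemma exists_roots_tendsto_I {ι : Type*} {F : Filter ι} {a s ρ η : ι → ℝ}
    (ha : Tendsto a F (𝓝 0)) (hs : Tendsto s F (𝓝 1)) (hρ : Tendsto ρ F (𝓝 0))
    (hη : Tendsto η F (𝓝 0)) (ha0 : ∀ᶠ t in F, a t ≠ 0) (hρ0 : ∀ᶠ t in F, ρ t ≠ 0) :
    ∃ z : ι → ℂ,
      (∀ t, z t ^ 4 + a t * z t ^ 3 + (s t + ρ t) * z t ^ 2 + s t * a t * z t + η t * ρ t = 0) ∧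
      Tendsto z F (𝓝 Complex.I) ∧
      Tendsto (fun t => (z t).re / (a t * ρ t)) F (𝓝 (-(1 / 2))) := by
  have hroot : ∀ t, ∃ z : ℂ,
      z ^ 4 + a t * z ^ 3 + (s t + ρ t) * z ^ 2 + s t * a t * z + η t * ρ t = 0 ∧
      ‖Complex.I - z‖ ^ 4 ≤ ‖(1 - Complex.I * a t - (s t + ρ t) + s t * a t * Complex.I
        + η t * ρ t : ℂ)‖ := by
    intro t
    let q : Polynomial ℂ := Polynomial.C (a t : ℂ) * Polynomial.X ^ 3 +
      Polynomial.C (s t + ρ t : ℂ) * Polynomial.X ^ 2 +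
      Polynomial.C (s t * a t : ℂ) * Polynomial.X + Polynomial.C (η t * ρ t : ℂ)
    have hq : q.degree < 4 := lt_of_le_of_lt Polynomial.degree_cubic_le (by norm_num)
    have hmonic : (Polynomial.X ^ 4 + q).Monic := Polynomial.monic_X_pow_add hq
    have hdeg : (Polynomial.X ^ 4 + q).natDegree = 4 := by
      apply Polynomial.natDegree_eq_of_degree_eq_some
      rw [Polynomial.degree_add_eq_left_of_degree_lt] <;> simp [hq]
    obtain ⟨r, hr, hle⟩ := hmonic.exists_root_norm_sub_pow_le (by simp [hdeg]) Complex.I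
    have heval : ∀ x : ℂ, (Polynomial.X ^ 4 + q).eval x =
        x ^ 4 + a t * x ^ 3 + (s t + ρ t) * x ^ 2 + s t * a t * x + η t * ρ t := by
      intro x
      simp [q]
      ring
    rw [heval] at hr hle
    rw [hdeg, Complex.I_pow_four, Complex.I_pow_three, Complex.I_sq] at hle
    exact ⟨r, hr, hle.trans_eq (by congr 1; ring)⟩
  choose z hz hle using hroot
  have hcast : ∀ {f : ι → ℝ} {c : ℝ}, Tendsto f F (𝓝 c) →
      Tendsto (fun t => (f t : ℂ)) F (𝓝 c) := fun h =>
    (Complex.continuous_ofReal.tendsto _).comp h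
  have hbound : Tendsto (fun t => ‖(1 - Complex.I * a t - (s t + ρ t) + s t * a t * Complex.I
      + η t * ρ t : ℂ)‖) F (𝓝 0) := by
    have h := (((((tendsto_const_nhds (x := (1 : ℂ))).sub ((hcast ha).const_mul Complex.I)).sub
      ((hcast hs).add (hcast hρ))).add (((hcast hs).mul (hcast ha)).mul_const Complex.I)).add
      ((hcast hη).mul (hcast hρ))).norm
    simpa using h
  have hzI : Tendsto z F (𝓝 Complex.I) := by
    have h4 : Tendsto (fun t => ‖Complex.I - z t‖ ^ 4) F (𝓝 0) :=
      squeeze_zero (fun t => by positivity) hle hbound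
    have h1 : Tendsto (fun t => (‖Complex.I - z t‖ ^ 4) ^ ((4 : ℝ)⁻¹)) F (𝓝 0) := by
      simpa using h4.rpow_const (p := (4 : ℝ)⁻¹) (Or.inr (by norm_num))
    rw [tendsto_iff_norm_sub_tendsto_zero]
    refine h1.congr fun t => ?_
    rw [norm_sub_rev]
    exact Real.pow_rpow_inv_natCast (norm_nonneg _) (n := 4) (by norm_num)
  refine ⟨z, hz, hzI, ?_⟩
  have hu : Tendsto (fun t => (z t).re) F (𝓝 0) := by
    simpa [Function.comp_def] using (Complex.continuous_re.tendsto _).comp hzI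
  have hv : Tendsto (fun t => (z t).im) F (𝓝 1) := by
    simpa [Function.comp_def] using (Complex.continuous_im.tendsto _).comp hzI
  have hN : Tendsto (fun t => (z t).re ^ 2 + (z t).im ^ 2) F (𝓝 1) := by
    simpa using (hu.pow 2).add (hv.pow 2)
  have hK : Tendsto (fun t => ((z t).re + a t) ^ 2 + (z t).im ^ 2) F (𝓝 1) := by
    simpa using ((hu.add ha).pow 2).add (hv.pow 2)
  have hden : Tendsto (fun t => ((z t).re ^ 2 + (z t).im ^ 2) *
      (((z t).re + a t) ^ 2 + (z t).im ^ 2) - η t * ρ t) F (𝓝 1) := by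
    simpa using (hN.mul hK).sub (hη.mul hρ)
  have hlim := (hη.sub hN).div (hden.const_mul 2) (by norm_num)
  rw [show (0 - 1) / (2 * 1) = (-(1 / 2) : ℝ) by norm_num] at hlim
  refine hlim.congr' ?_
  filter_upwards [ha0, hρ0, hv.eventually_ne one_ne_zero, hden.eventually_ne one_ne_zero]
    with t hat hρt hvt hdt
  have hrel := re_relation_of_root (hz t) hvt
  simp only [Pi.div_apply]
  rw [div_eq_div_iff (by simpa using hdt) (by positivity)]
  linear_combination -hrel

/-- Scaling of the characteristic polynomial by `w = μ ^ ((2α - γ) / 2)`. -/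
lemma charPoly_scaled {α β γ μ : ℝ} (hμ : 0 < μ) (z : ℂ) :
    charPoly α β γ μ ((μ ^ ((2 * α - γ) / 2) : ℝ) * z) =
      (((μ ^ γ + 1) * (μ ^ ((2 * α - γ) / 2)) ^ 4 : ℝ) : ℂ) *
      (z ^ 4 + ((μ ^ (-((2 * α - γ) / 2)) : ℝ) : ℂ) * z ^ 3 +
        (((1 + 2 * μ ^ (-(2 * α - 1))) / (1 + μ ^ (-γ)) : ℝ) +
          (μ ^ (-(2 * α - β - γ)) : ℝ)) * z ^ 2 +
        ((1 + 2 * μ ^ (-(2 * α - 1))) / (1 + μ ^ (-γ)) : ℝ) *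
          (μ ^ (-((2 * α - γ) / 2)) : ℝ) * z +
        (2 * μ ^ (-(2 * α - 1)) / (1 + μ ^ (-γ)) : ℝ) * (μ ^ (-(2 * α - β - γ)) : ℝ)) := by
  obtain ⟨w, hw⟩ : ∃ w, w = μ ^ ((2 * α - γ) / 2) := ⟨_, rfl⟩
  have hw0 : 0 < w := hw ▸ rpow_pos_of_pos hμ _
  have hg0 : 0 < μ ^ γ := rpow_pos_of_pos hμ _
  have hb0 : 0 < μ ^ β := rpow_pos_of_pos hμ _
  have hα : μ ^ (2 * α) = w ^ 2 * μ ^ γ := by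
    rw [hw, ← rpow_natCast, ← rpow_mul hμ.le, ← rpow_add hμ]
    congr 1
    push_cast
    ring
  have e1 : μ ^ (-(2 * α - 1)) = μ / (w ^ 2 * μ ^ γ) := by
    rw [neg_sub, rpow_sub hμ, rpow_one, hα]
  have e2 : μ ^ (-(2 * α - β - γ)) = μ ^ β / w ^ 2 := by
    rw [show -(2 * α - β - γ) = β + γ - 2 * α by ring, rpow_sub hμ, rpow_add hμ, hα]
    field_simp
  have e3 : μ ^ (-((2 * α - γ) / 2)) = w⁻¹ := by rw [rpow_neg hμ.le, hw]
  have e4 : 1 + μ ^ (-γ) = (μ ^ γ + 1) / μ ^ γ := by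
    rw [rpow_neg hμ.le]
    field_simp
  rw [charPoly, ← hw, e1, e2, e3, e4, hα, rpow_add hμ, rpow_add hμ, rpow_one]
  obtain ⟨g, hg⟩ : ∃ g, g = μ ^ γ := ⟨_, rfl⟩
  rw [← hg] at hg0 ⊢
  have hgc : (g : ℂ) ≠ 0 := by exact_mod_cast hg0.ne'
  have hwc : (w : ℂ) ≠ 0 := by exact_mod_cast hw0.ne'
  have hdc : (g : ℂ) + 1 ≠ 0 := by exact_mod_cast (by positivity : g + 1 ≠ 0)
  push_cast
  field_simp
  ring

theorem charPoly_roots_T1_optimality (α β γ : ℝ)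
    (h1 : 1 / 2 < α) (h2 : α < (β + 1) / 2) (h3 : 0 < β) (h4 : β ≤ 1)
    (h5 : 0 < γ) (h6 : γ < 2 * α - β) :
    ∃ l : ℝ → ℂ, ∃ M > (0 : ℝ),
      (∀ μ > M, charPoly α β γ μ (l μ) = 0) ∧
      Tendsto (fun μ : ℝ =>
          |(l μ).re| * |(l μ).im| ^ (2 * (2 * α - β - γ) / (2 * α - γ))) atTop (𝓝 (1 / 2)) ∧
      Tendsto (fun μ : ℝ => |(l μ).im|) atTop atTop := by
  have hp : 0 < 2 * α - γ := by linarith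
  have hpow : ∀ {c : ℝ}, 0 < c → Tendsto (fun μ : ℝ => μ ^ (-c)) atTop (𝓝 0) :=
    fun hc => tendsto_rpow_neg_atTop hc
  have hx := (hpow (c := 2 * α - 1) (by linarith)).const_mul 2
  have hd := (hpow h5).const_add 1
  have hs : Tendsto (fun μ : ℝ => (1 + 2 * μ ^ (-(2 * α - 1))) / (1 + μ ^ (-γ))) atTop (𝓝 1) := by
    simpa [Pi.div_def] using (hx.const_add 1).div hd (by norm_num)
  have hη : Tendsto (fun μ : ℝ => 2 * μ ^ (-(2 * α - 1)) / (1 + μ ^ (-γ))) atTop (𝓝 0) := by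
    simpa [Pi.div_def] using hx.div hd (by norm_num)
  have hpos : ∀ c : ℝ, ∀ᶠ μ : ℝ in atTop, μ ^ c ≠ 0 := fun c => by
    filter_upwards [eventually_gt_atTop 0] with μ hμ using (rpow_pos_of_pos hμ c).ne'
  obtain ⟨z, hz, hzI, hre⟩ := exists_roots_tendsto_I
    (hpow (c := (2 * α - γ) / 2) (by linarith)) hs (hpow (c := 2 * α - β - γ) (by linarith)) hη
    (hpos _) (hpos _)
  have hv : Tendsto (fun μ => |(z μ).im|) atTop (𝓝 1) := by
    simpa using ((Complex.continuous_im.tendsto _).comp hzI).abs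
  refine ⟨fun μ => (μ ^ ((2 * α - γ) / 2) : ℝ) * z μ, 1, one_pos, fun μ hμ => ?_, ?_, ?_⟩
  · rw [charPoly_scaled (one_pos.trans hμ), hz, mul_zero]
  · have hlim := hre.abs.mul
      (hv.rpow_const (p := 2 * (2 * α - β - γ) / (2 * α - γ)) (Or.inl one_ne_zero))
    rw [one_rpow, mul_one, abs_neg, abs_of_pos (by norm_num : (0 : ℝ) < 1 / 2)] at hlim
    refine hlim.congr' ?_
    filter_upwards [eventually_gt_atTop 0] with μ hμ
    have hw := rpow_pos_of_pos hμ ((2 * α - γ) / 2)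
    have hr := rpow_pos_of_pos hμ (2 * α - β - γ)
    have hwe : (μ ^ ((2 * α - γ) / 2)) ^ (2 * (2 * α - β - γ) / (2 * α - γ)) =
        μ ^ (2 * α - β - γ) := by
      rw [← rpow_mul hμ.le]
      congr 1
      field_simp
    rw [Complex.re_ofReal_mul, Complex.im_ofReal_mul, abs_mul, abs_mul, abs_of_pos hw,
      mul_rpow hw.le (abs_nonneg _), hwe, rpow_neg hμ.le, rpow_neg hμ.le, abs_div, abs_mul,
      abs_inv, abs_inv, abs_of_pos hw, abs_of_pos hr]
    field_simp
  · simp only [Complex.im_ofReal_mul, abs_mul]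
    exact (tendsto_abs_atTop_atTop.comp (tendsto_rpow_atTop (by linarith))).atTop_mul_pos
      one_pos hv
end
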